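/- arXiv:0811.4488 — 7 statements merged into one kernel-verified Lean document; each statement's English description precedes it below -/
import Mathlib

section
/- For every k ≥ 0 and every x ∈ [a,b], |X̃^{(2k)}(x)| ≤ (max_{[a,b]} |r u0²|)^k · (max_{[a,b]} |1/(p u0²)|)^k · (b - a)^{2k} / (2k)!. -/
open Set MeasureTheory Filter

/-- `X̃⁽ⁿ⁾`: `X̃⁽⁰⁾ ≡ 1`; for `n ≥ 1` odd, integrate against `u0² r`; for `n` even,
against `1/(u0² p)`. -/
noncomputable def Xt (u0 p r : ℝ → ℂ) (x0 : ℝ) : ℕ → ℝ → ℂ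
  | 0 => fun _ => 1
  | n + 1 =>
    if (n + 1) % 2 = 1 then
      fun x => ∫ s in x0..x, Xt u0 p r x0 n s * (u0 s ^ 2 * r s)
    else
      fun x => ∫ s in x0..x, Xt u0 p r x0 n s / (u0 s ^ 2 * p s)

/-- `X⁽ⁿ⁾`: `X⁽⁰⁾ ≡ 1`; for `n ≥ 1` odd, integrate against `1/(u0² p)`; for `n` even,
against `u0² r`. -/
noncomputable def Xo (u0 p r : ℝ → ℂ) (x0 : ℝ) : ℕ → ℝ → ℂ
  | 0 => fun _ => 1
  | n + 1 =>
    if (n + 1) % 2 = 1 then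
      fun x => ∫ s in x0..x, Xo u0 p r x0 n s / (u0 s ^ 2 * p s)
    else
      fun x => ∫ s in x0..x, Xo u0 p r x0 n s * (u0 s ^ 2 * r s)

/-- The SPPS solution `u1 = u0 · Σ_{k=0}^∞ λ^k X̃^{(2k)}`. -/
noncomputable def u1f (u0 p r : ℝ → ℂ) (x0 : ℝ) (lam : ℂ) (x : ℝ) : ℂ :=
  u0 x * ∑' k : ℕ, lam ^ k * Xt u0 p r x0 (2 * k) x

/-- The SPPS solution `u2 = u0 · Σ_{k=0}^∞ λ^k X^{(2k+1)}`. -/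
noncomputable def u2f (u0 p r : ℝ → ℂ) (x0 : ℝ) (lam : ℂ) (x : ℝ) : ℂ :=
  u0 x * ∑' k : ℕ, lam ^ k * Xo u0 p r x0 (2 * k + 1) x

/-- Integrating a power bound based at `x0` raises the power and divides by the new exponent. -/
theorem norm_intervalIntegral_mul_le_pow_div_factorial {a b x0 x A M : ℝ} {g w : ℝ → ℂ} {n : ℕ}
    (hx0 : x0 ∈ Set.Icc a b) (hx : x ∈ Set.Icc a b)
    (hg : ∀ s ∈ Set.Icc a b, ‖g s‖ ≤ A * (|s - x0| ^ n / n.factorial))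
    (hw : ∀ s ∈ Set.Icc a b, ‖w s‖ ≤ M) :
    ‖∫ s in x0..x, g s * w s‖ ≤ A * M * (|x - x0| ^ (n + 1) / (n + 1).factorial) := by
  have hsub : Set.uIoc x0 x ⊆ Set.Icc a b :=
    Set.uIoc_subset_uIcc.trans (Set.uIcc_subset_Icc hx0 hx)
  have hint : IntegrableOn (fun s : ℝ => A * M / n.factorial * |s - x0| ^ n) (Set.uIoc x0 x) :=
    ((by fun_prop : Continuous fun s : ℝ => A * M / n.factorial * |s - x0| ^ n).integrableOn_uIcc
      (a := x0) (b := x)).mono_set Set.uIoc_subset_uIcc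
  calc ‖∫ s in x0..x, g s * w s‖ = ‖∫ s in Set.uIoc x0 x, g s * w s‖ :=
        intervalIntegral.norm_intervalIntegral_eq _ _ _ _
    _ ≤ ∫ s in Set.uIoc x0 x, A * M / n.factorial * |s - x0| ^ n := by
        refine norm_integral_le_of_norm_le hint ?_
        filter_upwards [ae_restrict_mem measurableSet_uIoc] with s hs
        rw [norm_mul]
        calc ‖g s‖ * ‖w s‖ ≤ A * (|s - x0| ^ n / n.factorial) * M :=
              mul_le_mul (hg s (hsub hs)) (hw s (hsub hs)) (norm_nonneg _)
                ((norm_nonneg _).trans (hg s (hsub hs)))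
          _ = A * M / n.factorial * |s - x0| ^ n := by ring
    _ = A * M * (|x - x0| ^ (n + 1) / (n + 1).factorial) := by
        rw [integral_const_mul, integral_pow_abs_sub_uIoc, Nat.factorial_succ]
        push_cast
        field_simp

theorem Xt_odd (u0 p r : ℝ → ℂ) (x0 : ℝ) (k : ℕ) (x : ℝ) :
    Xt u0 p r x0 (2 * k + 1) x =
      ∫ s in x0..x, Xt u0 p r x0 (2 * k) s * (u0 s ^ 2 * r s) := by
  rw [Xt, if_pos (by omega)]

theorem Xt_even_succ (u0 p r : ℝ → ℂ) (x0 : ℝ) (k : ℕ) (x : ℝ) :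
    Xt u0 p r x0 (2 * (k + 1)) x =
      ∫ s in x0..x, Xt u0 p r x0 (2 * k + 1) s * (1 / (u0 s ^ 2 * p s)) := by
  rw [show 2 * (k + 1) = 2 * k + 1 + 1 by ring, Xt, if_neg (by omega)]
  simp only [mul_one_div]

/-- Pointwise bound for the even iterates from uniform bounds on the two weights. -/
theorem norm_Xt_even_le {a b x0 R P : ℝ} {u0 p r : ℝ → ℂ} (hx0 : x0 ∈ Set.Icc a b)
    (hR : ∀ s ∈ Set.Icc a b, ‖u0 s ^ 2 * r s‖ ≤ R)
    (hP : ∀ s ∈ Set.Icc a b, ‖1 / (u0 s ^ 2 * p s)‖ ≤ P) (k : ℕ) :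
    ∀ x ∈ Set.Icc a b, ‖Xt u0 p r x0 (2 * k) x‖ ≤
      R ^ k * P ^ k * (|x - x0| ^ (2 * k) / (2 * k).factorial) := by
  induction k with
  | zero => intro x _; simp [Xt]
  | succ k ih =>
    intro x hx
    have hodd : ∀ s ∈ Set.Icc a b, ‖Xt u0 p r x0 (2 * k + 1) s‖ ≤
        R ^ k * P ^ k * R * (|s - x0| ^ (2 * k + 1) / (2 * k + 1).factorial) := fun s hs => by
      rw [Xt_odd]
      exact norm_intervalIntegral_mul_le_pow_div_factorial hx0 hs ih hR
    rw [Xt_even_succ]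
    refine (norm_intervalIntegral_mul_le_pow_div_factorial hx0 hx hodd hP).trans_eq ?_
    rw [show 2 * (k + 1) = 2 * k + 1 + 1 by ring]
    ring

theorem ContinuousOn.norm_le_sSup_image_Icc {a b : ℝ} {f : ℝ → ℂ}
    (hf : ContinuousOn f (Set.Icc a b)) {s : ℝ} (hs : s ∈ Set.Icc a b) :
    ‖f s‖ ≤ sSup ((fun t => ‖f t‖) '' Set.Icc a b) :=
  le_csSup (isCompact_Icc.bddAbove_image hf.norm) (Set.mem_image_of_mem _ hs)

theorem Xt_even_bound
    (a b : ℝ) (hab : a < b) (p q r u0 : ℝ → ℂ)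
    (hu0ne : ∀ x ∈ Set.Icc a b, u0 x ≠ 0)
    (hu0d : ∀ x ∈ Set.Icc a b, DifferentiableAt ℝ u0 x ∧
      DifferentiableAt ℝ (fun y => p y * deriv u0 y) x)
    (hu0sol : ∀ x ∈ Set.Icc a b, deriv (fun y => p y * deriv u0 y) x + q x * u0 x = 0)
    (hcr : ContinuousOn (fun x => u0 x ^ 2 * r x) (Set.Icc a b))
    (hcp : ContinuousOn (fun x => 1 / (u0 x ^ 2 * p x)) (Set.Icc a b))
    (x0 : ℝ) (hx0 : x0 ∈ Set.Icc a b) (hpc : ContinuousAt p x0) (hp0 : p x0 ≠ 0)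
    (k : ℕ) (x : ℝ) (hx : x ∈ Set.Icc a b) :
    ‖Xt u0 p r x0 (2 * k) x‖ ≤
      (sSup ((fun s => ‖r s * u0 s ^ 2‖) '' Set.Icc a b)) ^ k *
      (sSup ((fun s => ‖1 / (p s * u0 s ^ 2)‖) '' Set.Icc a b)) ^ k *
      (b - a) ^ (2 * k) / (Nat.factorial (2 * k)) := by
  simp only [mul_comm (r _), mul_comm (p _)]
  have hR := fun s (hs : s ∈ Set.Icc a b) => hcr.norm_le_sSup_image_Icc hs
  have hP := fun s (hs : s ∈ Set.Icc a b) => hcp.norm_le_sSup_image_Icc hs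
  refine (norm_Xt_even_le hx0 hR hP k x hx).trans ?_
  rw [← mul_div_assoc]
  have hR0 := (norm_nonneg _).trans (hR x hx)
  have hP0 := (norm_nonneg _).trans (hP x hx)
  have hdist : |x - x0| ≤ b - a := abs_sub_le_of_le_of_le hx.1 hx.2 hx0.1 hx0.2
  gcongr
end

section
/- For every λ ∈ ℂ the series Σ_{k=0}^∞ λ^k X̃^{(2k)}(x) and Σ_{k=0}^∞ λ^k X^{(2k+1)}(x) converge uniformly with respect to x on [a,b]. -/
open Set MeasureTheory Filter

/-- Integrating a function bounded by `(M |s - x₀|)ⁿ / n!` against a weight bounded by `M` gives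
a function bounded by `(M |x - x₀|)ⁿ⁺¹ / (n + 1)!`. -/
theorem norm_intervalIntegral_le_pow_div_factorial {M x₀ x : ℝ} {n : ℕ} {f w g : ℝ → ℂ}
    (hf : ∀ s ∈ Set.uIcc x₀ x, ‖f s‖ ≤ (M * |s - x₀|) ^ n / n.factorial)
    (hw : ∀ s ∈ Set.uIcc x₀ x, ‖w s‖ ≤ M) (hg : ∀ s, g s = f s * w s) :
    ‖∫ s in x₀..x, g s‖ ≤ (M * |x - x₀|) ^ (n + 1) / (n + 1).factorial := by
  have hM : 0 ≤ M := (norm_nonneg _).trans (hw x₀ Set.left_mem_uIcc)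
  have hint : IntegrableOn (fun s : ℝ => M ^ (n + 1) / n.factorial * |s - x₀| ^ n)
      (Set.uIoc x₀ x) := by
    rw [← intervalIntegrable_iff]
    exact Continuous.intervalIntegrable (by fun_prop) _ _
  rw [intervalIntegral.norm_intervalIntegral_eq]
  calc ‖∫ s in Set.uIoc x₀ x, g s‖
      ≤ ∫ s in Set.uIoc x₀ x, M ^ (n + 1) / n.factorial * |s - x₀| ^ n := by
        refine norm_integral_le_of_norm_le hint ?_
        refine (ae_restrict_iff' measurableSet_uIoc).2 (Eventually.of_forall fun s hs => ?_)
        have hs' := Set.uIoc_subset_uIcc hs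
        rw [hg, norm_mul]
        calc ‖f s‖ * ‖w s‖ ≤ (M * |s - x₀|) ^ n / n.factorial * M :=
              mul_le_mul (hf s hs') (hw s hs') (norm_nonneg _) (by positivity)
          _ = M ^ (n + 1) / n.factorial * |s - x₀| ^ n := by ring
    _ = (M * |x - x₀|) ^ (n + 1) / (n + 1).factorial := by
        rw [integral_const_mul, integral_pow_abs_sub_uIoc, Nat.factorial_succ]
        push_cast
        field_simp
        rw [mul_pow]

theorem norm_Xt_le {a b x0 M : ℝ} {u0 p r : ℝ → ℂ} (hx0 : x0 ∈ Set.Icc a b)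
    (hr : ∀ x ∈ Set.Icc a b, ‖u0 x ^ 2 * r x‖ ≤ M)
    (hp : ∀ x ∈ Set.Icc a b, ‖1 / (u0 x ^ 2 * p x)‖ ≤ M) (n : ℕ) :
    ∀ x ∈ Set.Icc a b, ‖Xt u0 p r x0 n x‖ ≤ (M * |x - x0|) ^ n / n.factorial := by
  induction n with
  | zero => intro x _; simp [Xt]
  | succ n ih =>
    intro x hx
    have hsub := Set.uIcc_subset_Icc hx0 hx
    rw [Xt]
    split_ifs
    · exact norm_intervalIntegral_le_pow_div_factorial (fun s hs => ih s (hsub hs))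
        (fun s hs => hr s (hsub hs)) fun s => rfl
    · exact norm_intervalIntegral_le_pow_div_factorial (fun s hs => ih s (hsub hs))
        (fun s hs => hp s (hsub hs)) fun s => div_eq_mul_one_div _ _

theorem norm_Xo_le {a b x0 M : ℝ} {u0 p r : ℝ → ℂ} (hx0 : x0 ∈ Set.Icc a b)
    (hr : ∀ x ∈ Set.Icc a b, ‖u0 x ^ 2 * r x‖ ≤ M)
    (hp : ∀ x ∈ Set.Icc a b, ‖1 / (u0 x ^ 2 * p x)‖ ≤ M) (n : ℕ) :
    ∀ x ∈ Set.Icc a b, ‖Xo u0 p r x0 n x‖ ≤ (M * |x - x0|) ^ n / n.factorial := by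
  induction n with
  | zero => intro x _; simp [Xo]
  | succ n ih =>
    intro x hx
    have hsub := Set.uIcc_subset_Icc hx0 hx
    rw [Xo]
    split_ifs
    · exact norm_intervalIntegral_le_pow_div_factorial (fun s hs => ih s (hsub hs))
        (fun s hs => hp s (hsub hs)) fun s => div_eq_mul_one_div _ _
    · exact norm_intervalIntegral_le_pow_div_factorial (fun s hs => ih s (hsub hs))
        (fun s hs => hr s (hsub hs)) fun s => rfl

theorem tendstoUniformlyOn_tsum_pow_mul_of_norm_le_pow_div_factorial {α : Type*} {S : Set α}
    {F : ℕ → α → ℂ} {C : ℝ}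
    (hF : ∀ n, ∀ x ∈ S, ‖F n x‖ ≤ C ^ n / n.factorial)
    {φ : ℕ → ℕ} (hφ : Function.Injective φ) (hle : ∀ k, k ≤ φ k) (lam : ℂ) :
    TendstoUniformlyOn (fun (N : ℕ) x => ∑ k ∈ Finset.range N, lam ^ k * F (φ k) x)
      (fun x => ∑' k : ℕ, lam ^ k * F (φ k) x) Filter.atTop S := by
  refine tendstoUniformlyOn_tsum_nat
    ((Real.summable_pow_div_factorial (max 1 ‖lam‖ * C)).comp_injective hφ) fun k x hx => ?_
  have hpow : ‖lam‖ ^ k ≤ max 1 ‖lam‖ ^ φ k :=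
    (pow_le_pow_left₀ (norm_nonneg _) (le_max_right _ _) k).trans
      (pow_le_pow_right₀ (le_max_left _ _) (hle k))
  rw [norm_mul, norm_pow, Function.comp_apply, mul_pow, mul_div_assoc]
  exact mul_le_mul hpow (hF _ x hx) (norm_nonneg _) (by positivity)

theorem SPPS_series_converge_uniformly
    (a b : ℝ) (hab : a < b) (p q r u0 : ℝ → ℂ)
    (hu0ne : ∀ x ∈ Set.Icc a b, u0 x ≠ 0)
    (hu0d : ∀ x ∈ Set.Icc a b, DifferentiableAt ℝ u0 x ∧
      DifferentiableAt ℝ (fun y => p y * deriv u0 y) x)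
    (hu0sol : ∀ x ∈ Set.Icc a b, deriv (fun y => p y * deriv u0 y) x + q x * u0 x = 0)
    (hcr : ContinuousOn (fun x => u0 x ^ 2 * r x) (Set.Icc a b))
    (hcp : ContinuousOn (fun x => 1 / (u0 x ^ 2 * p x)) (Set.Icc a b))
    (x0 : ℝ) (hx0 : x0 ∈ Set.Icc a b) (hpc : ContinuousAt p x0) (hp0 : p x0 ≠ 0)
    (lam : ℂ) :
    TendstoUniformlyOn
      (fun (N : ℕ) (x : ℝ) => ∑ k ∈ Finset.range N, lam ^ k * Xt u0 p r x0 (2 * k) x)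
      (fun x => ∑' k : ℕ, lam ^ k * Xt u0 p r x0 (2 * k) x) Filter.atTop (Set.Icc a b) ∧
    TendstoUniformlyOn
      (fun (N : ℕ) (x : ℝ) => ∑ k ∈ Finset.range N, lam ^ k * Xo u0 p r x0 (2 * k + 1) x)
      (fun x => ∑' k : ℕ, lam ^ k * Xo u0 p r x0 (2 * k + 1) x) Filter.atTop (Set.Icc a b) := by
  obtain ⟨M₁, hr⟩ := isCompact_Icc.exists_bound_of_continuousOn hcr
  obtain ⟨M₂, hp⟩ := isCompact_Icc.exists_bound_of_continuousOn hcp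
  have hr' : ∀ x ∈ Set.Icc a b, ‖u0 x ^ 2 * r x‖ ≤ max M₁ M₂ :=
    fun x hx => (hr x hx).trans (le_max_left _ _)
  have hp' : ∀ x ∈ Set.Icc a b, ‖1 / (u0 x ^ 2 * p x)‖ ≤ max M₁ M₂ :=
    fun x hx => (hp x hx).trans (le_max_right _ _)
  have hM : 0 ≤ max M₁ M₂ := (norm_nonneg _).trans (hr' x0 hx0)
  have hdist : ∀ n : ℕ, ∀ x ∈ Set.Icc a b, (max M₁ M₂ * |x - x0|) ^ n / n.factorial ≤
      (max M₁ M₂ * (b - a)) ^ n / n.factorial := by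
    intro n x hx
    have := abs_sub_le_of_le_of_le hx.1 hx.2 hx0.1 hx0.2
    gcongr
  exact ⟨tendstoUniformlyOn_tsum_pow_mul_of_norm_le_pow_div_factorial
      (fun n x hx => (norm_Xt_le hx0 hr' hp' n x hx).trans (hdist n x hx))
      (fun _ _ h => by simpa using h) (fun k => by lia) lam,
    tendstoUniformlyOn_tsum_pow_mul_of_norm_le_pow_div_factorial
      (fun n x hx => (norm_Xo_le hx0 hr' hp' n x hx).trans (hdist n x hx))
      (fun _ _ h => by simpa using h) (fun k => by lia) lam⟩
end

section
/- Polya factorization of the Sturm-Liouville operator: if u0 is a non-vanishing twice-differentiable function on an open interval I with (p u0')' + q u0 = 0 on I, then for every twice-differentiable function v : I → ℂ and every x ∈ I, (p v')'(x) + q(x) v(x) = (1/u0(x)) · d/dx [ p u0² · (v/u0)' ](x). -/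
open Set

theorem polya_factorization
    (A B : ℝ) (p q u0 : ℝ → ℂ)
    (hp : ∀ x ∈ Set.Ioo A B, DifferentiableAt ℝ p x)
    (hu0d : ∀ x ∈ Set.Ioo A B, DifferentiableAt ℝ u0 x ∧ DifferentiableAt ℝ (deriv u0) x)
    (hu0ne : ∀ x ∈ Set.Ioo A B, u0 x ≠ 0)
    (hu0sol : ∀ x ∈ Set.Ioo A B,
      deriv (fun y => p y * deriv u0 y) x + q x * u0 x = 0)
    (v : ℝ → ℂ)
    (hv : ∀ x ∈ Set.Ioo A B, DifferentiableAt ℝ v x ∧ DifferentiableAt ℝ (deriv v) x)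
    (x : ℝ) (hx : x ∈ Set.Ioo A B) :
    deriv (fun y => p y * deriv v y) x + q x * v x
      = (1 / u0 x) *
        deriv (fun y => p y * u0 y ^ 2 * deriv (fun z => v z / u0 z) y) x := by
  have hev : (fun y => p y * u0 y ^ 2 * deriv (fun z => v z / u0 z) y) =ᶠ[nhds x]
      fun y => p y * deriv v y * u0 y - p y * deriv u0 y * v y := by
    filter_upwards [isOpen_Ioo.mem_nhds hx] with y hy
    have hne := hu0ne y hy
    rw [((hv y hy).1.hasDerivAt.fun_div (hu0d y hy).1.hasDerivAt hne).deriv]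
    field_simp
  have hpv := ((hp x hx).fun_mul (hv x hx).2).hasDerivAt
  have hpu := ((hp x hx).fun_mul (hu0d x hx).2).hasDerivAt
  have hne := hu0ne x hx
  rw [hev.deriv_eq, ((hpv.fun_mul (hu0d x hx).1.hasDerivAt).fun_sub
    (hpu.fun_mul (hv x hx).1.hasDerivAt)).deriv, eq_neg_of_add_eq_zero_left (hu0sol x hx)]
  field_simp
  ring
end

section
/- Double-integral collapse formula: for even n ≥ 2 and x ∈ [a,b], X̃^{(n)}(x) = ∫_{x0}^x (P(x) − P(t)) · u0(t)² r(t) · X̃^{(n−2)}(t) dt, where P(x) = ∫_{x0}^x ds/(u0(s)² p(s)). -/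
open Set MeasureTheory Filter

theorem continuousOn_primitive_of_continuousOn {c x : ℝ} {f : ℝ → ℂ}
    (hf : ContinuousOn f (uIcc c x)) :
    ContinuousOn (fun t => ∫ s in c..t, f s) (uIcc c x) :=
  intervalIntegral.continuousOn_primitive_interval
    (hf.integrableOn_compact isCompact_uIcc)

theorem hasDerivAt_primitive_of_continuousOn {c x t : ℝ} {f : ℝ → ℂ}
    (hf : ContinuousOn f (uIcc c x)) (ht : t ∈ Ioo (min c x) (max c x)) :
    HasDerivAt (fun t => ∫ s in c..t, f s) (f t) t := by
  have hmem : Ioo (min c x) (max c x) ⊆ uIcc c x := Ioo_subset_Icc_self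
  refine intervalIntegral.integral_hasDerivAt_right
    (hf.mono (uIcc_subset_uIcc_left (hmem ht))).intervalIntegrable
    ((hf.mono hmem).stronglyMeasurableAtFilter isOpen_Ioo t ht)
    ((hf.mono hmem).continuousAt (isOpen_Ioo.mem_nhds ht))

/-- An iterated integral of two continuous functions collapses to a single integral. -/
theorem integral_primitive_mul_eq {c x : ℝ} {f g : ℝ → ℂ}
    (hf : ContinuousOn f (uIcc c x)) (hg : ContinuousOn g (uIcc c x)) :
    ∫ t in c..x, (∫ s in c..t, f s) * g t =
      ∫ t in c..x, ((∫ s in c..x, g s) - ∫ s in c..t, g s) * f t := by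
  have hparts := intervalIntegral.integral_mul_deriv_eq_deriv_mul_of_hasDeriv_right
    (v := fun t => (∫ s in c..t, g s) - ∫ s in c..x, g s)
    (continuousOn_primitive_of_continuousOn hf)
    ((continuousOn_primitive_of_continuousOn hg).sub continuousOn_const)
    (fun t ht => (hasDerivAt_primitive_of_continuousOn hf ht).hasDerivWithinAt)
    (fun t ht => ((hasDerivAt_primitive_of_continuousOn hg ht).sub_const _).hasDerivWithinAt)
    hf.intervalIntegrable hg.intervalIntegrable
  rw [hparts, sub_self, mul_zero, intervalIntegral.integral_same, zero_mul, sub_zero, zero_sub,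
    ← intervalIntegral.integral_neg]
  congr 1 with t
  ring

theorem continuousOn_Xt {u0 p r : ℝ → ℂ} {c x : ℝ}
    (hr : ContinuousOn (fun t => u0 t ^ 2 * r t) (uIcc c x))
    (hp : ContinuousOn (fun t => 1 / (u0 t ^ 2 * p t)) (uIcc c x)) (n : ℕ) :
    ContinuousOn (Xt u0 p r c n) (uIcc c x) := by
  induction n with
  | zero => exact continuousOn_const
  | succ n ih =>
    rw [Xt]
    split_ifs
    · exact continuousOn_primitive_of_continuousOn (ih.mul hr)
    · exact continuousOn_primitive_of_continuousOn ((ih.mul hp).congr fun t _ => div_eq_mul_one_div _ _)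

theorem Xt_double_integral_collapse
    (a b : ℝ) (hab : a < b) (p q r u0 : ℝ → ℂ)
    (hu0ne : ∀ x ∈ Set.Icc a b, u0 x ≠ 0)
    (hu0d : ∀ x ∈ Set.Icc a b, DifferentiableAt ℝ u0 x ∧
      DifferentiableAt ℝ (fun y => p y * deriv u0 y) x)
    (hu0sol : ∀ x ∈ Set.Icc a b, deriv (fun y => p y * deriv u0 y) x + q x * u0 x = 0)
    (hcr : ContinuousOn (fun x => u0 x ^ 2 * r x) (Set.Icc a b))
    (hcp : ContinuousOn (fun x => 1 / (u0 x ^ 2 * p x)) (Set.Icc a b))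
    (x0 : ℝ) (hx0 : x0 ∈ Set.Icc a b) (hpc : ContinuousAt p x0) (hp0 : p x0 ≠ 0)
    (n : ℕ) (hn2 : 2 ≤ n) (hneven : n % 2 = 0) (x : ℝ) (hx : x ∈ Set.Icc a b) :
    Xt u0 p r x0 n x =
      ∫ t in x0..x,
        ((∫ s in x0..x, 1 / (u0 s ^ 2 * p s)) - (∫ s in x0..t, 1 / (u0 s ^ 2 * p s))) *
          (u0 t ^ 2 * r t) * Xt u0 p r x0 (n - 2) t := by
  have hsub : uIcc x0 x ⊆ Icc a b := uIcc_subset_Icc hx0 hx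
  have hr := hcr.mono hsub
  have hp := hcp.mono hsub
  obtain ⟨m, rfl⟩ := Nat.exists_eq_add_of_le' hn2
  have hm : (m + 1) % 2 = 1 := by omega
  have hm' : ¬(m + 1 + 1) % 2 = 1 := by omega
  have hcollapse := integral_primitive_mul_eq ((continuousOn_Xt hr hp m).mul hr) hp
  simp only [Xt, if_pos hm, if_neg hm', Nat.add_sub_cancel]
  simp only [div_eq_mul_one_div (intervalIntegral _ _ _ _)]
  refine hcollapse.trans ?_
  congr 1 with t
  rw [Pi.mul_apply]
  ring
end

section
/- Existence of a non-vanishing solution in the complex case: if v1 and v2 are linearly independent twice-differentiable solutions of (p u')' + q u = 0 on (a,b), where p, q : (a,b) → ℂ, then there exist complex constants c1, c2 such that the solution c1 v1 + c2 v2 has no zeros in (a,b). Moreover, on the set A1 = {x ∈ (a,b) : v1(x) ≠ 0}, the set of c ∈ ℂ for which c·v1 + v2 has a zero in A1 has Lebesgue measure zero. -/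
open Set MeasureTheory

/-- The image of a set of reals under a differentiable map into `ℂ` is Lebesgue-null. -/
theorem volume_image_eq_zero_of_differentiableAt {f : ℝ → ℂ} {s : Set ℝ}
    (hf : ∀ x ∈ s, DifferentiableAt ℝ f x) : volume (f '' s) = 0 := by
  have hline : volume (LinearMap.ker Complex.imLm : Set ℂ) = 0 := by
    refine Measure.addHaar_submodule volume _ fun h => ?_
    have hI : Complex.I ∈ LinearMap.ker Complex.imLm := h ▸ Submodule.mem_top
    simp at hI
  have hs : volume (Complex.ofReal '' s) = 0 := by
    refine measure_mono_null ?_ hline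
    rintro _ ⟨x, -, rfl⟩
    simp
  have hd : DifferentiableOn ℝ (f ∘ Complex.re) (Complex.ofReal '' s) := by
    rintro _ ⟨x, hx, rfl⟩
    exact (DifferentiableAt.comp (x : ℂ) (hf x hx)
      Complex.reCLM.differentiableAt).differentiableWithinAt
  simpa [image_image] using
    addHaar_image_eq_zero_of_differentiableOn_of_addHaar_eq_zero volume hd hs

theorem nonvanishing_solution_exists_complex_case
    (a b : ℝ) (hab : a < b) (p q : ℝ → ℂ)
    (hp : ∀ x ∈ Set.Ioo a b, DifferentiableAt ℝ p x)
    (v1 v2 : ℝ → ℂ)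
    (hv1d : ∀ x ∈ Set.Ioo a b, DifferentiableAt ℝ v1 x ∧ DifferentiableAt ℝ (deriv v1) x)
    (hv2d : ∀ x ∈ Set.Ioo a b, DifferentiableAt ℝ v2 x ∧ DifferentiableAt ℝ (deriv v2) x)
    (hv1c : ContinuousOn (deriv v1) (Set.Ioo a b))
    (hv2c : ContinuousOn (deriv v2) (Set.Ioo a b))
    (hv1sol : ∀ x ∈ Set.Ioo a b, deriv (fun y => p y * deriv v1 y) x + q x * v1 x = 0)
    (hv2sol : ∀ x ∈ Set.Ioo a b, deriv (fun y => p y * deriv v2 y) x + q x * v2 x = 0)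
    (hli : ∀ c1 c2 : ℂ, (∀ x ∈ Set.Ioo a b, c1 * v1 x + c2 * v2 x = 0) → c1 = 0 ∧ c2 = 0)
    (hW : ∀ x ∈ Set.Ioo a b, p x * (v1 x * deriv v2 x - deriv v1 x * v2 x) ≠ 0) :
    (∃ c1 c2 : ℂ, ∀ x ∈ Set.Ioo a b, c1 * v1 x + c2 * v2 x ≠ 0) ∧
    volume {c : ℂ | ∃ x ∈ Set.Ioo a b, v1 x ≠ 0 ∧ c * v1 x + v2 x = 0} = 0 := by
  have hnull : volume {c : ℂ | ∃ x ∈ Set.Ioo a b, v1 x ≠ 0 ∧ c * v1 x + v2 x = 0} = 0 := by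
    refine measure_mono_null ?_ (volume_image_eq_zero_of_differentiableAt
      (f := fun x => -v2 x / v1 x) (s := {x ∈ Ioo a b | v1 x ≠ 0})
      fun x hx => (hv2d x hx.1).1.neg.div (hv1d x hx.1).1 hx.2)
    rintro c ⟨x, hx, h0, hc⟩
    exact ⟨x, ⟨hx, h0⟩, (eq_div_of_mul_eq h0 (eq_neg_of_add_eq_zero_left hc)).symm⟩
  refine ⟨?_, hnull⟩
  obtain ⟨c, hc⟩ : ∃ c, c ∉ {c : ℂ | ∃ x ∈ Set.Ioo a b, v1 x ≠ 0 ∧ c * v1 x + v2 x = 0} :=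
    (measure_eq_zero_iff_ae_notMem.1 hnull).exists
  refine ⟨c, 1, fun x hx h => ?_⟩
  rw [one_mul] at h
  by_cases h0 : v1 x = 0
  · have h2 : v2 x = 0 := by simpa [h0] using h
    exact hW x hx (by simp [h0, h2])
  · exact hc ⟨x, hx, h0, h⟩
end

section
/- Tail estimate for the truncated SPPS: for every N ≥ 0 and every x ∈ [a,b], |u1(x) − u0(x) Σ_{k=0}^N λ^k X̃^{(2k)}(x)| ≤ (max_{[a,b]} |u0|) · Σ_{k=N+1}^∞ c^k/(2k)! = (max_{[a,b]} |u0|) · (cosh√c − Σ_{k=0}^N c^k/(2k)!), where c = |λ| · (max_{[a,b]} |r u0²|) · (max_{[a,b]} |1/(p u0²)|) · (b − a)². -/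
open Set MeasureTheory Filter

theorem norm_intervalIntegral_mul_le_of_norm_le_pow {s : Set ℝ} [s.OrdConnected] {f g : ℝ → ℂ}
    {x0 x C M : ℝ} {n : ℕ} (hx0 : x0 ∈ s) (hx : x ∈ s)
    (hf : ∀ t ∈ s, ‖f t‖ ≤ C * (|t - x0| ^ n / n.factorial)) (hg : ∀ t ∈ s, ‖g t‖ ≤ M) :
    ‖∫ t in x0..x, f t * g t‖ ≤ C * M * (|x - x0| ^ (n + 1) / (n + 1).factorial) := by
  have hsub : uIoc x0 x ⊆ s := uIoc_subset_uIcc.trans (OrdConnected.uIcc_subset ‹_› hx0 hx)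
  have hint : IntegrableOn (fun t => C * M / n.factorial * |t - x0| ^ n) (uIoc x0 x) :=
    (Continuous.integrableOn_Icc (by fun_prop)).mono_set uIoc_subset_uIcc
  rw [intervalIntegral.norm_integral_eq_norm_integral_uIoc]
  refine (norm_integral_le_of_norm_le hint
    ((ae_restrict_iff' measurableSet_uIoc).2 (.of_forall fun t ht => ?_))).trans_eq ?_
  · have hft := hf t (hsub ht)
    calc ‖f t * g t‖ ≤ C * (|t - x0| ^ n / n.factorial) * M := by
          rw [norm_mul]
          exact mul_le_mul hft (hg t (hsub ht)) (norm_nonneg _) ((norm_nonneg _).trans hft)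
      _ = C * M / n.factorial * |t - x0| ^ n := by ring
  · rw [integral_const_mul, integral_pow_abs_sub_uIoc, Nat.factorial_succ]
    push_cast
    field_simp

theorem norm_Xt_two_mul_le {s : Set ℝ} [s.OrdConnected] {u0 p r : ℝ → ℂ} {x0 A B : ℝ}
    (hx0 : x0 ∈ s) (hA : ∀ t ∈ s, ‖u0 t ^ 2 * r t‖ ≤ A) (hB : ∀ t ∈ s, ‖1 / (u0 t ^ 2 * p t)‖ ≤ B)
    (k : ℕ) : ∀ x ∈ s,
      ‖Xt u0 p r x0 (2 * k) x‖ ≤ (A * B) ^ k * (|x - x0| ^ (2 * k) / (2 * k).factorial) := by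
  induction k with
  | zero => intro x _; simp [Xt]
  | succ k ih =>
    have hodd : ∀ x ∈ s, ‖Xt u0 p r x0 (2 * k + 1) x‖ ≤
        (A * B) ^ k * A * (|x - x0| ^ (2 * k + 1) / (2 * k + 1).factorial) := fun x hx => by
      rw [Xt, if_pos (by omega)]
      exact norm_intervalIntegral_mul_le_of_norm_le_pow hx0 hx ih hA
    intro x hx
    rw [show 2 * (k + 1) = 2 * k + 1 + 1 by ring, Xt, if_neg (by omega)]
    simp only [div_eq_mul_one_div (Xt _ _ _ _ _ _)]
    exact (norm_intervalIntegral_mul_le_of_norm_le_pow hx0 hx hodd hB).trans_eq (by ring)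

theorem hasSum_cosh_sqrt {c : ℝ} (hc : 0 ≤ c) :
    HasSum (fun k : ℕ => c ^ k / (2 * k).factorial) (Real.cosh √c) := by
  simpa only [pow_mul, Real.sq_sqrt hc] using Real.hasSum_cosh √c

theorem SPPS_tail_estimate
    (a b : ℝ) (hab : a < b) (p q r u0 : ℝ → ℂ)
    (hu0ne : ∀ x ∈ Set.Icc a b, u0 x ≠ 0)
    (hu0d : ∀ x ∈ Set.Icc a b, DifferentiableAt ℝ u0 x ∧
      DifferentiableAt ℝ (fun y => p y * deriv u0 y) x)
    (hu0sol : ∀ x ∈ Set.Icc a b, deriv (fun y => p y * deriv u0 y) x + q x * u0 x = 0)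
    (hcr : ContinuousOn (fun x => u0 x ^ 2 * r x) (Set.Icc a b))
    (hcp : ContinuousOn (fun x => 1 / (u0 x ^ 2 * p x)) (Set.Icc a b))
    (x0 : ℝ) (hx0 : x0 ∈ Set.Icc a b) (hpc : ContinuousAt p x0) (hp0 : p x0 ≠ 0)
    (lam : ℂ) (N : ℕ) (x : ℝ) (hx : x ∈ Set.Icc a b) :
    ‖u1f u0 p r x0 lam x
        - u0 x * ∑ k ∈ Finset.range (N + 1), lam ^ k * Xt u0 p r x0 (2 * k) x‖ ≤
      (sSup ((fun s => ‖u0 s‖) '' Set.Icc a b)) *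
        ∑' k : ℕ, (‖lam‖ * sSup ((fun s => ‖r s * u0 s ^ 2‖) '' Set.Icc a b) *
            sSup ((fun s => ‖1 / (p s * u0 s ^ 2)‖) '' Set.Icc a b) * (b - a) ^ 2) ^ (N + 1 + k)
          / (Nat.factorial (2 * (N + 1 + k))) ∧
    ∑' k : ℕ, (‖lam‖ * sSup ((fun s => ‖r s * u0 s ^ 2‖) '' Set.Icc a b) *
          sSup ((fun s => ‖1 / (p s * u0 s ^ 2)‖) '' Set.Icc a b) * (b - a) ^ 2) ^ (N + 1 + k)
        / (Nat.factorial (2 * (N + 1 + k)))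
      = Real.cosh (Real.sqrt (‖lam‖ * sSup ((fun s => ‖r s * u0 s ^ 2‖) '' Set.Icc a b) *
            sSup ((fun s => ‖1 / (p s * u0 s ^ 2)‖) '' Set.Icc a b) * (b - a) ^ 2))
        - ∑ k ∈ Finset.range (N + 1),
            (‖lam‖ * sSup ((fun s => ‖r s * u0 s ^ 2‖) '' Set.Icc a b) *
              sSup ((fun s => ‖1 / (p s * u0 s ^ 2)‖) '' Set.Icc a b) * (b - a) ^ 2) ^ k
            / (Nat.factorial (2 * k)) := by
  have hle {f : ℝ → ℂ} (hf : ContinuousOn f (Icc a b)) (t : ℝ) (ht : t ∈ Icc a b) :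
      ‖f t‖ ≤ sSup ((fun s => ‖f s‖) '' Icc a b) :=
    le_csSup (isCompact_Icc.bddAbove_image hf.norm) (mem_image_of_mem _ ht)
  have hU := hle fun t ht => (hu0d t ht).1.continuousAt.continuousWithinAt
  have hA := hle hcr
  have hB := hle hcp
  simp only [mul_comm (r _), mul_comm (p _)]
  set A := sSup ((fun s => ‖u0 s ^ 2 * r s‖) '' Icc a b)
  set B := sSup ((fun s => ‖1 / (u0 s ^ 2 * p s)‖) '' Icc a b)
  have hA0 : 0 ≤ A := (norm_nonneg _).trans (hA x hx)
  have hB0 : 0 ≤ B := (norm_nonneg _).trans (hB x hx)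
  set c := ‖lam‖ * A * B * (b - a) ^ 2 with hc
  have hc0 : 0 ≤ c := by positivity
  have hcosh := hasSum_cosh_sqrt hc0
  have hterm (k : ℕ) : ‖lam ^ k * Xt u0 p r x0 (2 * k) x‖ ≤ c ^ k / (2 * k).factorial := by
    have hxx0 : |x - x0| ≤ b - a := abs_sub_le_of_le_of_le hx.1 hx.2 hx0.1 hx0.2
    calc ‖lam ^ k * Xt u0 p r x0 (2 * k) x‖
        ≤ ‖lam‖ ^ k * ((A * B) ^ k * (|x - x0| ^ (2 * k) / (2 * k).factorial)) := by
          rw [norm_mul, norm_pow]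
          gcongr
          exact norm_Xt_two_mul_le hx0 hA hB k x hx
      _ ≤ ‖lam‖ ^ k * ((A * B) ^ k * ((b - a) ^ (2 * k) / (2 * k).factorial)) := by gcongr
      _ = c ^ k / (2 * k).factorial := by simp only [hc, pow_mul, mul_pow, mul_div_assoc, mul_assoc]
  have hsum : Summable fun k : ℕ => lam ^ k * Xt u0 p r x0 (2 * k) x :=
    .of_norm_bounded hcosh.summable hterm
  have hshift (k : ℕ) : N + 1 + k = k + (N + 1) := add_comm _ _
  simp only [hshift]
  constructor
  · rw [u1f, ← mul_sub, ← hsum.sum_add_tsum_nat_add (N + 1), add_sub_cancel_left, norm_mul]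
    refine mul_le_mul (hU x hx) ?_ (norm_nonneg _) ((norm_nonneg _).trans (hU x hx))
    exact tsum_of_norm_bounded ((summable_nat_add_iff (N + 1)).2 hcosh.summable).hasSum
      fun k => hterm _
  · rw [← hcosh.tsum_eq, ← hcosh.summable.sum_add_tsum_nat_add (N + 1), add_sub_cancel_left]
end

section
/- Derivative formulas for the SPPS solutions: at every x ∈ (a,b) where p is continuous and nonzero, u1'(x) = (u0'(x)/u0(x)) u1(x) + (1/(u0(x) p(x))) Σ_{k=1}^∞ λ^k X̃^{(2k−1)}(x) and u2'(x) = (u0'(x)/u0(x)) u2(x) + (1/(u0(x) p(x))) Σ_{k=0}^∞ λ^k X^{(2k)}(x). -/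
open Set MeasureTheory Filter

/-- `Y` is the sequence of iterated integrals based at `x0` with successive weights `w n`. -/
structure IsIteratedIntegral (w Y : ℕ → ℝ → ℂ) (x0 : ℝ) : Prop where
  zero : ∀ x, Y 0 x = 1
  succ : ∀ n x, Y (n + 1) x = ∫ s in x0..x, Y n s * w n s

lemma summable_pow_mul_pow_div_factorial (l C : ℝ) (hl : 0 ≤ l) (hC : 0 ≤ C) (j : ℕ) :
    Summable fun k : ℕ => l ^ k * (C ^ (2 * k + j) / (2 * k + j).factorial) := by
  have hinj : Function.Injective fun k : ℕ => 2 * k + j := fun m n h => by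
    simp only at h; omega
  refine Summable.of_nonneg_of_le (fun k => by positivity) (fun k => ?_)
    ((Real.summable_pow_div_factorial (max 1 l * C)).comp_injective hinj)
  have h : l ^ k ≤ max 1 l ^ (2 * k + j) :=
    (pow_le_pow_left₀ hl (le_max_right _ _) k).trans
      (pow_le_pow_right₀ (le_max_left _ _) (by omega))
  simp only [Function.comp_apply, mul_pow, mul_div_assoc]
  gcongr

namespace IsIteratedIntegral

variable {w Y : ℕ → ℝ → ℂ} {a b x0 M : ℝ}

lemma continuousOn (hY : IsIteratedIntegral w Y x0) (hab : a ≤ b) (hx0 : x0 ∈ Icc a b)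
    (hw : ∀ n, ContinuousOn (w n) (Icc a b)) (n : ℕ) : ContinuousOn (Y n) (Icc a b) := by
  induction n with
  | zero => exact continuousOn_const.congr fun x _ => hY.zero x
  | succ n ih =>
    have h := intervalIntegral.continuousOn_primitive_interval' (a := x0) (μ := volume)
      ((ih.mul (hw n)).intervalIntegrable_of_Icc hab) (by rwa [uIcc_of_le hab])
    rw [uIcc_of_le hab] at h
    exact h.congr fun x _ => hY.succ n x

lemma hasDerivAt (hY : IsIteratedIntegral w Y x0) (hx0 : x0 ∈ Icc a b)
    (hw : ∀ n, ContinuousOn (w n) (Icc a b)) (n : ℕ) {x : ℝ} (hx : x ∈ Ioo a b) :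
    HasDerivAt (Y (n + 1)) (Y n x * w n x) x := by
  have hc : ContinuousOn (fun s => Y n s * w n s) (Icc a b) :=
    (hY.continuousOn (hx0.1.trans hx0.2) hx0 hw n).mul (hw n)
  have hc' := hc.mono Ioo_subset_Icc_self
  rw [show Y (n + 1) = _ from funext (hY.succ n)]
  exact intervalIntegral.integral_hasDerivAt_right
    (hc.mono (uIcc_subset_Icc hx0 (Ioo_subset_Icc_self hx))).intervalIntegrable
    (hc'.stronglyMeasurableAtFilter isOpen_Ioo x hx)
    (hc'.continuousAt (isOpen_Ioo.mem_nhds hx))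

lemma norm_le_pow_abs_sub (hY : IsIteratedIntegral w Y x0) (hx0 : x0 ∈ Icc a b)
    (hM : ∀ n, ∀ x ∈ Icc a b, ‖w n x‖ ≤ M) (n : ℕ) :
    ∀ x ∈ Icc a b, ‖Y n x‖ ≤ (M * |x - x0|) ^ n / n.factorial := by
  have hM0 : 0 ≤ M := (norm_nonneg _).trans (hM 0 x0 hx0)
  induction n with
  | zero => intro x _; simp [hY.zero]
  | succ n ih =>
    intro x hx
    rw [hY.succ]
    have hbound : ∀ s ∈ uIoc x0 x,
        ‖Y n s * w n s‖ ≤ M ^ (n + 1) / n.factorial * |s - x0| ^ n := by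
      intro s hs
      have hs' : s ∈ Icc a b := uIcc_subset_Icc hx0 hx (uIoc_subset_uIcc hs)
      calc ‖Y n s * w n s‖ ≤ (M * |s - x0|) ^ n / n.factorial * M := by
            rw [norm_mul]
            exact mul_le_mul (ih s hs') (hM n s hs') (norm_nonneg _) (by positivity)
        _ = _ := by ring
    refine (intervalIntegral.norm_integral_le_abs_of_norm_le
      (g := fun s => M ^ (n + 1) / n.factorial * |s - x0| ^ n)
      ((ae_restrict_iff' measurableSet_uIoc).2 (ae_of_all _ hbound))
      (Continuous.intervalIntegrable (by fun_prop) _ _)).trans_eq ?_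
    rw [intervalIntegral.integral_const_mul, abs_mul,
      intervalIntegral.abs_integral_eq_abs_integral_uIoc, integral_pow_abs_sub_uIoc,
      abs_of_nonneg (by positivity), abs_of_nonneg (by positivity), Nat.factorial_succ]
    push_cast
    field_simp
    ring

lemma norm_le_pow (hY : IsIteratedIntegral w Y x0) (hx0 : x0 ∈ Icc a b)
    (hM : ∀ n, ∀ x ∈ Icc a b, ‖w n x‖ ≤ M) (n : ℕ) {x : ℝ} (hx : x ∈ Icc a b) :
    ‖Y n x‖ ≤ (M * (b - a)) ^ n / n.factorial := by
  have hM0 : 0 ≤ M := (norm_nonneg _).trans (hM 0 x0 hx0)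
  refine (hY.norm_le_pow_abs_sub hx0 hM n x hx).trans ?_
  have : |x - x0| ≤ b - a := abs_sub_le_of_le_of_le hx.1 hx.2 hx0.1 hx0.2
  gcongr

lemma summable (hY : IsIteratedIntegral w Y x0) (hx0 : x0 ∈ Icc a b)
    (hM : ∀ n, ∀ x ∈ Icc a b, ‖w n x‖ ≤ M) (lam : ℂ) (j : ℕ) {x : ℝ} (hx : x ∈ Icc a b) :
    Summable fun k : ℕ => lam ^ k * Y (2 * k + j) x := by
  have hM0 : 0 ≤ M := (norm_nonneg _).trans (hM 0 x0 hx0)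
  have hC : 0 ≤ M * (b - a) := mul_nonneg hM0 (sub_nonneg.2 (hx0.1.trans hx0.2))
  refine .of_norm_bounded
    (summable_pow_mul_pow_div_factorial ‖lam‖ _ (norm_nonneg _) hC j) fun k => ?_
  rw [norm_mul, norm_pow]
  exact mul_le_mul_of_nonneg_left (hY.norm_le_pow hx0 hM _ hx) (by positivity)

/-- Termwise differentiation of the power series with every second iterated integral. -/
lemma hasDerivAt_tsum (hY : IsIteratedIntegral w Y x0) (hx0 : x0 ∈ Icc a b)
    (hw : ∀ n, ContinuousOn (w n) (Icc a b)) (hM : ∀ n, ∀ x ∈ Icc a b, ‖w n x‖ ≤ M)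
    (lam : ℂ) (j : ℕ) {x : ℝ} (hx : x ∈ Ioo a b) :
    HasDerivAt (fun y => ∑' k : ℕ, lam ^ k * Y (2 * k + j + 1) y)
      (∑' k : ℕ, lam ^ k * (Y (2 * k + j) x * w (2 * k + j) x)) x := by
  have hM0 : 0 ≤ M := (norm_nonneg _).trans (hM 0 x0 hx0)
  have hC : 0 ≤ M * (b - a) := mul_nonneg hM0 (sub_nonneg.2 (hx0.1.trans hx0.2))
  refine hasDerivAt_tsum_of_isPreconnected
    (g' := fun k y => lam ^ k * (Y (2 * k + j) y * w (2 * k + j) y))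
    ((summable_pow_mul_pow_div_factorial ‖lam‖ _ (norm_nonneg _) hC j).mul_right M)
    isOpen_Ioo isPreconnected_Ioo
    (fun k y hy => (hY.hasDerivAt hx0 hw (2 * k + j) hy).const_mul _)
    (fun k y hy => ?_) hx
    (hY.summable hx0 hM lam (j + 1) (Ioo_subset_Icc_self hx)) hx
  have hy' := Ioo_subset_Icc_self hy
  rw [norm_mul, norm_mul, norm_pow, mul_assoc]
  exact mul_le_mul_of_nonneg_left
    (mul_le_mul (hY.norm_le_pow hx0 hM _ hy') (hM _ y hy') (norm_nonneg _) (by positivity))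
    (by positivity)

end IsIteratedIntegral

/-- The weights `f, g, f, g, …`. -/
def alternatingWeight (f g : ℝ → ℂ) (n : ℕ) : ℝ → ℂ := if n % 2 = 0 then f else g

lemma alternatingWeight_even (f g : ℝ → ℂ) (k : ℕ) : alternatingWeight f g (2 * k) = f := by
  simp [alternatingWeight]

lemma alternatingWeight_odd (f g : ℝ → ℂ) (k : ℕ) : alternatingWeight f g (2 * k + 1) = g :=
  if_neg (by omega)

lemma continuousOn_alternatingWeight {f g : ℝ → ℂ} {s : Set ℝ} (hf : ContinuousOn f s)
    (hg : ContinuousOn g s) (n : ℕ) : ContinuousOn (alternatingWeight f g n) s := by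
  unfold alternatingWeight
  split_ifs
  exacts [hf, hg]

lemma exists_norm_alternatingWeight_le {f g : ℝ → ℂ} {s : Set ℝ} (hs : IsCompact s)
    (hf : ContinuousOn f s) (hg : ContinuousOn g s) :
    ∃ M, ∀ n, ∀ x ∈ s, ‖alternatingWeight f g n x‖ ≤ M := by
  obtain ⟨A, hA⟩ := hs.exists_bound_of_continuousOn hf
  obtain ⟨B, hB⟩ := hs.exists_bound_of_continuousOn hg
  refine ⟨max A B, fun n x hx => ?_⟩
  unfold alternatingWeight
  split_ifs
  exacts [(hA x hx).trans (le_max_left _ _), (hB x hx).trans (le_max_right _ _)]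

lemma isIteratedIntegral_Xt (u0 p r : ℝ → ℂ) (x0 : ℝ) :
    IsIteratedIntegral (alternatingWeight (fun x => u0 x ^ 2 * r x)
      (fun x => 1 / (u0 x ^ 2 * p x))) (Xt u0 p r x0) x0 where
  zero _ := by simp [Xt]
  succ n x := by
    rcases Nat.mod_two_eq_zero_or_one n with h | h
    · rw [Xt, if_pos (by omega), alternatingWeight, if_pos h]
    · rw [Xt, if_neg (by omega), alternatingWeight, if_neg (by omega)]
      simp only [div_eq_mul_one_div (Xt u0 p r x0 n _)]

lemma isIteratedIntegral_Xo (u0 p r : ℝ → ℂ) (x0 : ℝ) :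
    IsIteratedIntegral (alternatingWeight (fun x => 1 / (u0 x ^ 2 * p x))
      (fun x => u0 x ^ 2 * r x)) (Xo u0 p r x0) x0 where
  zero _ := by simp [Xo]
  succ n x := by
    rcases Nat.mod_two_eq_zero_or_one n with h | h
    · rw [Xo, if_pos (by omega), alternatingWeight, if_pos h]
      simp only [div_eq_mul_one_div (Xo u0 p r x0 n _)]
    · rw [Xo, if_neg (by omega), alternatingWeight, if_neg (by omega)]

theorem SPPS_derivative_formulas
    (a b : ℝ) (hab : a < b) (p q r u0 : ℝ → ℂ)
    (hu0ne : ∀ x ∈ Set.Icc a b, u0 x ≠ 0)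
    (hu0d : ∀ x ∈ Set.Icc a b, DifferentiableAt ℝ u0 x ∧
      DifferentiableAt ℝ (fun y => p y * deriv u0 y) x)
    (hu0sol : ∀ x ∈ Set.Icc a b, deriv (fun y => p y * deriv u0 y) x + q x * u0 x = 0)
    (hcr : ContinuousOn (fun x => u0 x ^ 2 * r x) (Set.Icc a b))
    (hcp : ContinuousOn (fun x => 1 / (u0 x ^ 2 * p x)) (Set.Icc a b))
    (x0 : ℝ) (hx0 : x0 ∈ Set.Icc a b) (hpc : ContinuousAt p x0) (hp0 : p x0 ≠ 0)
    (lam : ℂ) (x : ℝ) (hx : x ∈ Set.Ioo a b) (hpcx : ContinuousAt p x) (hpx : p x ≠ 0) :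
    deriv (u1f u0 p r x0 lam) x
      = deriv u0 x / u0 x * u1f u0 p r x0 lam x
        + 1 / (u0 x * p x) * ∑' k : ℕ, lam ^ (k + 1) * Xt u0 p r x0 (2 * k + 1) x ∧
    deriv (u2f u0 p r x0 lam) x
      = deriv u0 x / u0 x * u2f u0 p r x0 lam x
        + 1 / (u0 x * p x) * ∑' k : ℕ, lam ^ k * Xo u0 p r x0 (2 * k) x := by
  have hxI := Ioo_subset_Icc_self hx
  have hne : u0 x ≠ 0 := hu0ne x hxI
  have hu0 : HasDerivAt u0 (deriv u0 x) x := (hu0d x hxI).1.hasDerivAt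
  constructor
  · have hY := isIteratedIntegral_Xt u0 p r x0
    have hw := continuousOn_alternatingWeight hcr hcp
    obtain ⟨M, hM⟩ := exists_norm_alternatingWeight_le isCompact_Icc hcr hcp
    have hsplit : (fun y => ∑' k : ℕ, lam ^ k * Xt u0 p r x0 (2 * k) y) =ᶠ[nhds x]
        fun y => 1 + lam * ∑' k : ℕ, lam ^ k * Xt u0 p r x0 (2 * k + 1 + 1) y := by
      filter_upwards [isOpen_Ioo.mem_nhds hx] with y hy
      have hs := hY.summable hx0 hM lam 0 (Ioo_subset_Icc_self hy)
      simp only [add_zero] at hs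
      rw [hs.tsum_eq_zero_add, ← tsum_mul_left]
      simp [hY.zero, pow_succ', mul_assoc, mul_add]
    have hS := (((hY.hasDerivAt_tsum hx0 hw hM lam 1 hx).const_mul lam).const_add
      1).congr_of_eventuallyEq hsplit
    have h : HasDerivAt (u1f u0 p r x0 lam) _ x := hu0.mul hS
    rw [h.deriv]
    simp only [u1f, alternatingWeight_odd, pow_succ', mul_assoc lam, tsum_mul_left]
    simp only [← mul_assoc, tsum_mul_right]
    field_simp
  · have hY := isIteratedIntegral_Xo u0 p r x0
    have hw := continuousOn_alternatingWeight hcp hcr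
    obtain ⟨M, hM⟩ := exists_norm_alternatingWeight_le isCompact_Icc hcp hcr
    have hS := hY.hasDerivAt_tsum hx0 hw hM lam 0 hx
    have h : HasDerivAt (u2f u0 p r x0 lam) _ x := hu0.mul hS
    rw [h.deriv]
    simp only [u2f, add_zero, alternatingWeight_even, ← mul_assoc, tsum_mul_right]
    field_simp
end
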